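/- arXiv:2406.05440 — 3 statements merged into one kernel-verified Lean document; each statement's English description precedes it below -/
import Mathlib

section
/- Let {X_i} and {Y_i} be ℓ-independent sequences of real random variables such that E[X_i^a Y_j^b] ≤ κ₀ < ∞ for all indices i, j with |j−i| < ℓ and all integers a, b with 0 ≤ a, b ≤ 4 satisfying (a = b or a + b ≤ 4); moreover, for all i, j with |j−i| ≥ ℓ, X_i is independent of Y_j and E[X_i Y_j] = 0. Let {σ_n}_{n≥1} be a sequence of random permutations, independent of each other and of the sequences {X_i}, {Y_i}, where σ_n is a uniform random permutation of [n]. Then (1/n) ∑_{i=1}^{n} X_i Y_{σ_n(i)} → 0 almost surely as n → ∞. -/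
open MeasureTheory ProbabilityTheory Filter
open scoped ENNReal NNReal Topology

noncomputable section

/-- A sequence of random elements is `ℓ`-independent if each `X t` is independent
of the joint family `{X k : |t - k| ≥ ℓ}`. -/
def LIndepSeq {Ω E : Type*} [MeasurableSpace Ω] [MeasurableSpace E]
    (ℓ : ℕ) (X : ℕ → Ω → E) (μ : Measure Ω) : Prop :=
  ∀ t : ℕ, IndepFun (X t)
    (fun ω => fun k : {k : ℕ // ℓ ≤ ((t : ℤ) - (k : ℤ)).natAbs} => X (k : ℕ) ω) μ

/-- `σ` is a uniform random permutation of `{0, …, n-1}`: each of the `n!`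
permutations has probability `1/n!`. -/
def IsUniformPerm {Ω : Type*} [MeasurableSpace Ω] {n : ℕ}
    (σ : Ω → Equiv.Perm (Fin n)) (μ : Measure Ω) : Prop :=
  ∀ e : Equiv.Perm (Fin n), μ {ω | σ ω = e} = (Nat.factorial n : ℝ≥0∞)⁻¹


/-- centred permutation statistic -/
def permStat {n : ℕ} (a b : Fin n → ℝ) (π : Equiv.Perm (Fin n)) : ℝ :=
  ∑ i, a i * b (π i) - (∑ i, a i) * (∑ i, b i) / n

lemma permStat_swap {n : ℕ} (a b : Fin n → ℝ) (π : Equiv.Perm (Fin n)) (I J : Fin n) :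
    permStat a b π - permStat a b (π * Equiv.swap I J) = (a I - a J) * (b (π I) - b (π J)) := by
  unfold permStat
  rw [sub_sub_sub_cancel_right, ← Finset.sum_sub_distrib]
  by_cases h : I = J
  · subst h; simp
  · rw [Fintype.sum_eq_add I J h]
    · simp; ring
    · rintro x ⟨h1, h2⟩
      simp [Equiv.swap_apply_of_ne_of_ne h1 h2]

lemma permStat_sum {n : ℕ} (hn : 0 < n) (a b : Fin n → ℝ) (π : Equiv.Perm (Fin n)) :
    ∑ I, ∑ J, (a I - a J) * (b (π I) - b (π J)) = 2 * n * permStat a b π := by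
  have hn' : (n : ℝ) ≠ 0 := by positivity
  have h1 : ∑ i, b (π i) = ∑ i, b i := Equiv.sum_comp π b
  have : ∀ I J, (a I - a J) * (b (π I) - b (π J)) =
    a I * b (π I) + a J * b (π J) - a I * b (π J) - a J * b (π I) := by intros; ring
  simp only [this, Finset.sum_sub_distrib, Finset.sum_add_distrib, Finset.sum_const,
    Finset.card_univ, Fintype.card_fin, ← Finset.mul_sum, ← Finset.sum_mul, h1, nsmul_eq_mul]
  unfold permStat
  field_simp
  ring

lemma permStat_four {n : ℕ} (a b : Fin n → ℝ) :
    ∑ π, permStat a b π ^ 4 ≤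
      36 * ∑ π : Equiv.Perm (Fin n), ∑ I, ∑ J, (a I ^ 4 + a J ^ 4) * (b (π I) ^ 4 + b (π J) ^ 4) := by
  rcases Nat.eq_zero_or_pos n with rfl | hn
  · simp [permStat]
  have hn' : (0 : ℝ) < n := by positivity
  set f := permStat a b with hf
  set D : Equiv.Perm (Fin n) → Fin n → Fin n → ℝ :=
    fun π I J => (a I - a J) * (b (π I) - b (π J)) with hD
  set V : Equiv.Perm (Fin n) → ℝ := fun π => ∑ I, ∑ J, D π I J ^ 2 with hV
  have key : ∀ I J, ∑ π, f π ^ 3 * D π I J ≤ 3 / 2 * ∑ π, f π ^ 2 * D π I J ^ 2 := by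
    intro I J
    set g : Equiv.Perm (Fin n) → ℝ := fun π => f (π * Equiv.swap I J) with hg
    have hDg : ∀ π, D π I J = f π - g π := fun π => (permStat_swap a b π I J).symm
    have hgg : ∀ π, g (π * Equiv.swap I J) = f π := by
      intro π; simp [hg, mul_assoc]
    have e1 : ∑ π, f π ^ 3 * (f π - g π) = ∑ π, g π ^ 3 * (g π - f π) := by
      rw [← Equiv.sum_comp (Equiv.mulRight (Equiv.swap I J))]
      simp [hg]
    have e2 : ∑ π, f π ^ 2 * (f π - g π) ^ 2 = ∑ π, g π ^ 2 * (g π - f π) ^ 2 := by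
      rw [← Equiv.sum_comp (Equiv.mulRight (Equiv.swap I J))]
      simp [hg]
    simp only [hDg]
    have e3 : ∑ π, f π ^ 3 * (f π - g π) + ∑ π, g π ^ 3 * (g π - f π) ≤
        3 / 2 * (∑ π, f π ^ 2 * (f π - g π) ^ 2 + ∑ π, g π ^ 2 * (g π - f π) ^ 2) := by
      rw [← Finset.sum_add_distrib, ← Finset.sum_add_distrib, Finset.mul_sum]
      apply Finset.sum_le_sum
      intro π _
      have : 0 ≤ ((f π - g π) ^ 2) ^ 2 := by positivity
      nlinarith
    linarith
  have h1 : 2 * n * ∑ π, f π ^ 4 ≤ 3 / 2 * ∑ π, f π ^ 2 * V π := by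
    have : 2 * n * ∑ π, f π ^ 4 = ∑ I, ∑ J, ∑ π, f π ^ 3 * D π I J := by
      calc 2 * n * ∑ π, f π ^ 4 = ∑ π, f π ^ 3 * (2 * n * f π) := by
            rw [Finset.mul_sum]; apply Finset.sum_congr rfl; intros; ring
        _ = ∑ π, ∑ I, ∑ J, f π ^ 3 * D π I J := by
            apply Finset.sum_congr rfl; intro π _
            rw [← permStat_sum hn, Finset.mul_sum]
            apply Finset.sum_congr rfl; intro I _
            rw [Finset.mul_sum]
        _ = _ := by
            rw [Finset.sum_comm]
            apply Finset.sum_congr rfl; intro I _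
            rw [Finset.sum_comm]
    have h2 : ∑ π, f π ^ 2 * V π = ∑ I, ∑ J, ∑ π, f π ^ 2 * D π I J ^ 2 := by
      simp only [hV, Finset.mul_sum]
      rw [Finset.sum_comm]
      apply Finset.sum_congr rfl; intro I _
      rw [Finset.sum_comm]
    rw [this, h2, Finset.mul_sum]
    apply Finset.sum_le_sum; intro I _
    rw [Finset.mul_sum]
    apply Finset.sum_le_sum; intro J _
    exact key I J
  have h2 : ∀ π, V π ^ 2 ≤ n ^ 2 * (64 * ∑ I, ∑ J, (a I ^ 4 + a J ^ 4) * (b (π I) ^ 4 + b (π J) ^ 4)) := by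
    intro π
    have hq : ∀ x y : ℝ, (x - y) ^ 4 ≤ 8 * (x ^ 4 + y ^ 4) := by
      intro x y
      have := sq_nonneg (x + y)
      have h2 : (x - y) ^ 2 ≤ 2 * (x ^ 2 + y ^ 2) := by nlinarith
      have h3 : ((x - y) ^ 2) ^ 2 ≤ (2 * (x ^ 2 + y ^ 2)) ^ 2 := by gcongr
      nlinarith [sq_nonneg (x ^ 2 - y ^ 2)]
    have hh : ∀ I J, D π I J ^ 4 ≤ 64 * ((a I ^ 4 + a J ^ 4) * (b (π I) ^ 4 + b (π J) ^ 4)) := by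
      intro I J
      have := mul_le_mul (hq (a I) (a J)) (hq (b (π I)) (b (π J))) (by positivity) (by positivity)
      simp only [hD, mul_pow]; linarith
    calc V π ^ 2 ≤ n * ∑ I, (∑ J, D π I J ^ 2) ^ 2 := by
          simpa using sq_sum_le_card_mul_sum_sq (s := Finset.univ) (f := fun I => ∑ J, D π I J ^ 2)
      _ ≤ n * ∑ I, (n * ∑ J, (D π I J ^ 2) ^ 2) := by
          gcongr with I _
          simpa using sq_sum_le_card_mul_sum_sq (s := Finset.univ) (f := fun J => D π I J ^ 2)
      _ = n ^ 2 * ∑ I, ∑ J, D π I J ^ 4 := by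
          rw [← Finset.mul_sum]; simp only [← pow_mul]; ring
      _ ≤ n ^ 2 * ∑ I, ∑ J, 64 * ((a I ^ 4 + a J ^ 4) * (b (π I) ^ 4 + b (π J) ^ 4)) := by
          gcongr with I _ J _
          exact hh I J
      _ = _ := by simp only [Finset.mul_sum]
  have h3 : 3 / 2 * ∑ π, f π ^ 2 * V π ≤ n * ∑ π, f π ^ 4 + n * (36 * ∑ π : Equiv.Perm (Fin n), ∑ I, ∑ J, (a I ^ 4 + a J ^ 4) * (b (π I) ^ 4 + b (π J) ^ 4)) := by
    simp only [Finset.mul_sum (s := (Finset.univ : Finset (Equiv.Perm (Fin n))))]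
    rw [← Finset.sum_add_distrib]
    apply Finset.sum_le_sum; intro π _
    have := h2 π
    set W := ∑ I, ∑ J, (a I ^ 4 + a J ^ 4) * (b (π I) ^ 4 + b (π J) ^ 4)
    have h4 : n * (3 / 2 * (f π ^ 2 * V π)) ≤ n * (n * f π ^ 4 + n * (36 * W)) := by
      nlinarith [sq_nonneg (n * f π ^ 2 - 3 / 4 * V π)]
    exact le_of_mul_le_mul_left h4 hn'
  have h5 : n * ∑ π, f π ^ 4 ≤ n * (36 * ∑ π : Equiv.Perm (Fin n), ∑ I, ∑ J, (a I ^ 4 + a J ^ 4) * (b (π I) ^ 4 + b (π J) ^ 4)) := by linarith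
  exact le_of_mul_le_mul_left h5 hn'


lemma ae_tendsto_of_four {Ω : Type*} [MeasurableSpace Ω] (μ : Measure Ω)
    (f : ℕ → Ω → ℝ) (G : ℕ → Ω → ℝ≥0∞) (hG : ∀ n, Measurable (G n)) (C : ℝ)
    (hGi : ∀ n, ∫⁻ ω, G n ω ∂μ ≤ ENNReal.ofReal (C * n ^ 2))
    (hfG : ∀ n ω, ENNReal.ofReal (f n ω ^ 4) ≤ G n ω) :
    ∀ᵐ ω ∂μ, Tendsto (fun n : ℕ => (n : ℝ)⁻¹ * f n ω) atTop (𝓝 0) := by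
  have h1 : ∫⁻ ω, ∑' n : ℕ, ENNReal.ofReal (((n : ℝ)⁻¹) ^ 4) * G n ω ∂μ ≠ ∞ := by
    rw [lintegral_tsum (fun n => ((hG n).const_mul _).aemeasurable)]
    have hs : Summable (fun n : ℕ => C * (((n : ℝ) ^ 2)⁻¹)) :=
      (Real.summable_nat_pow_inv.2 (by norm_num)).mul_left C
    refine ne_top_of_le_ne_top hs.tsum_ofReal_ne_top ?_
    refine ENNReal.tsum_le_tsum fun n => ?_
    rw [lintegral_const_mul _ (hG n)]
    refine (mul_le_mul_right (hGi n) _).trans ?_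
    rw [← ENNReal.ofReal_mul (by positivity)]
    apply ENNReal.ofReal_le_ofReal
    rcases Nat.eq_zero_or_pos n with rfl | hn
    · simp
    · have : (n : ℝ) ≠ 0 := by positivity
      apply le_of_eq; field_simp
  have hm : Measurable (fun ω => ∑' n : ℕ, ENNReal.ofReal (((n : ℝ)⁻¹) ^ 4) * G n ω) :=
    Measurable.tsum fun n => (hG n).const_mul _
  filter_upwards [ae_lt_top hm h1] with ω hω
  have h2 := ENNReal.tendsto_atTop_zero_of_tsum_ne_top hω.ne
  have h3 : Tendsto (fun n : ℕ => ENNReal.ofReal (((n : ℝ)⁻¹ * f n ω) ^ 4)) atTop (𝓝 0) := by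
    refine tendsto_of_tendsto_of_tendsto_of_le_of_le tendsto_const_nhds h2 (fun _ => zero_le) ?_
    intro n
    simp only [mul_pow]
    rw [ENNReal.ofReal_mul (by positivity)]
    exact mul_le_mul_right (hfG n ω) _
  have h4 : Tendsto (fun n : ℕ => ((n : ℝ)⁻¹ * f n ω) ^ 4) atTop (𝓝 0) := by
    have := (ENNReal.tendsto_toReal ENNReal.zero_ne_top).comp h3
    refine this.congr fun n => ?_
    simp only [Function.comp]
    rw [ENNReal.toReal_ofReal (by positivity)]
  have h5 := h4.sqrt.sqrt
  simp only [Real.sqrt_zero] at h5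
  rw [tendsto_zero_iff_abs_tendsto_zero]
  refine h5.congr fun n => ?_
  simp only [Function.comp]
  rw [show ∀ x : ℝ, x ^ 4 = (x ^ 2) ^ 2 by intro x; ring, Real.sqrt_sq (sq_nonneg _), Real.sqrt_sq_eq_abs]

lemma fourth_bound {Ω : Type*} [MeasurableSpace Ω] (μ : Measure Ω) [IsProbabilityMeasure μ]
    (U : ℕ → Ω → ℝ) (hU : ∀ n, MemLp (U n) 4 μ) (h0 : ∀ n, ∫ ω, U n ω ∂μ = 0) (K : ℝ)
    (hK : ∀ n, ∫ ω, U n ω ^ 4 ∂μ ≤ K)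
    (hind : ∀ n, IndepFun (fun ω => ∑ i ∈ Finset.range n, U i ω) (U n) μ) (n : ℕ) :
    MemLp (fun ω => ∑ i ∈ Finset.range n, U i ω) 4 μ ∧
    ∫ ω, (∑ i ∈ Finset.range n, U i ω) ∂μ = 0 ∧
    ∫ ω, (∑ i ∈ Finset.range n, U i ω) ^ 2 ∂μ ≤ (1 + K) * n ∧
    ∫ ω, (∑ i ∈ Finset.range n, U i ω) ^ 4 ∂μ ≤ 7 * (1 + K) ^ 2 * n ^ 2 := by
  have hpow : ∀ (f : Ω → ℝ), MemLp f 4 μ → ∀ k : ℕ, k ≤ 4 → Integrable (fun ω => f ω ^ k) μ := by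
    intro f hf k hk
    have h1 : MemLp f k μ := hf.mono_exponent (by exact_mod_cast hk)
    rcases Nat.eq_zero_or_pos k with rfl | hk0
    · simp
    have := h1.integrable_norm_pow hk0.ne'
    refine this.mono' (hf.1.pow k) (ae_of_all _ fun ω => by simp)
  have hKn : 0 ≤ K := (integral_nonneg (fun ω => by positivity)).trans (hK 0)
  have hU2 : ∀ n, ∫ ω, U n ω ^ 2 ∂μ ≤ 1 + K := by
    intro n
    calc ∫ ω, U n ω ^ 2 ∂μ ≤ ∫ ω, (1 + U n ω ^ 4) ∂μ := by
          apply integral_mono (hpow _ (hU n) 2 (by norm_num))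
            ((integrable_const _).add (hpow _ (hU n) 4 le_rfl))
          intro ω
          show U n ω ^ 2 ≤ 1 + U n ω ^ 4
          nlinarith [sq_nonneg (U n ω ^ 2 - 1)]
      _ = 1 + ∫ ω, U n ω ^ 4 ∂μ := by
          rw [integral_add (integrable_const _) (hpow _ (hU n) 4 le_rfl)]; simp
      _ ≤ _ := by linarith [hK n]
  induction n with
  | zero => simp
  | succ n ih =>
    obtain ⟨i1, i2, i3, i4⟩ := ih
    set S : Ω → ℝ := fun ω => ∑ i ∈ Finset.range n, U i ω with hS
    simp only [Finset.sum_range_succ]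
    have hI : IndepFun S (U n) μ := hind n
    have hcross : ∀ k l : ℕ, k ≤ 4 → l ≤ 4 → Integrable (fun ω => S ω ^ k * U n ω ^ l) μ ∧
        ∫ ω, S ω ^ k * U n ω ^ l ∂μ = (∫ ω, S ω ^ k ∂μ) * ∫ ω, U n ω ^ l ∂μ := by
      intro k l hk hl
      have hh : IndepFun (fun ω => S ω ^ k) (fun ω => U n ω ^ l) μ :=
        hI.comp (φ := fun x : ℝ => x ^ k) (ψ := fun x : ℝ => x ^ l) (by fun_prop) (by fun_prop)
      exact ⟨hh.integrable_mul (hpow _ i1 k hk) (hpow _ (hU n) l hl),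
        hh.integral_fun_mul_eq_mul_integral (i1.1.pow k) ((hU n).1.pow l)⟩
    have S1 : Integrable S μ := by simpa using hpow _ i1 1 (by norm_num)
    have U1 : Integrable (U n) μ := by simpa using hpow _ (hU n) 1 (by norm_num)
    refine ⟨i1.add (hU n), ?_, ?_, ?_⟩
    · rw [integral_add S1 U1, i2, h0]; simp
    · have e : ∀ ω, (S ω + U n ω) ^ 2 = S ω ^ 2 + 2 * (S ω ^ 1 * U n ω ^ 1) + U n ω ^ 2 := by
        intro ω; ring
      have c1 := hcross 1 1 (by norm_num) (by norm_num)
      have : ∫ ω, (S ω + U n ω) ^ 2 ∂μ = ∫ ω, S ω ^ 2 ∂μ + ∫ ω, U n ω ^ 2 ∂μ := by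
        simp only [e]
        rw [integral_add ((hpow _ i1 2 (by norm_num)).fun_add (c1.1.const_mul 2)) (hpow _ (hU n) 2 (by norm_num)),
          integral_add (hpow _ i1 2 (by norm_num)) (c1.1.const_mul 2), integral_const_mul, c1.2]
        simp [h0]
      rw [this]
      push_cast
      linarith [hU2 n]
    · have e : ∀ ω, (S ω + U n ω) ^ 4 = S ω ^ 4 + 4 * (S ω ^ 3 * U n ω ^ 1) + 6 * (S ω ^ 2 * U n ω ^ 2)
          + 4 * (S ω ^ 1 * U n ω ^ 3) + U n ω ^ 4 := by
        intro ω; ring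
      have c1 := hcross 3 1 (by norm_num) (by norm_num)
      have c2 := hcross 2 2 (by norm_num) (by norm_num)
      have c3 := hcross 1 3 (by norm_num) (by norm_num)
      have s4 := hpow _ i1 4 le_rfl
      have u4 := hpow _ (hU n) 4 le_rfl
      have d1 := c1.1.const_mul 4
      have d2 := c2.1.const_mul 6
      have d3 := c3.1.const_mul 4
      have : ∫ ω, (S ω + U n ω) ^ 4 ∂μ = ∫ ω, S ω ^ 4 ∂μ
          + 6 * ((∫ ω, S ω ^ 2 ∂μ) * ∫ ω, U n ω ^ 2 ∂μ) + ∫ ω, U n ω ^ 4 ∂μ := by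
        simp only [e]
        rw [integral_add (((s4.fun_add d1).fun_add d2).fun_add d3) u4, integral_add ((s4.fun_add d1).fun_add d2) d3,
          integral_add (s4.fun_add d1) d2, integral_add s4 d1, integral_const_mul, integral_const_mul,
          integral_const_mul, c1.2, c2.2, c3.2]
        simp [h0, i2]
      rw [this]
      have hm : (∫ ω, S ω ^ 2 ∂μ) * ∫ ω, U n ω ^ 2 ∂μ ≤ ((1 + K) * n) * (1 + K) :=
        mul_le_mul i3 (hU2 n) (integral_nonneg fun ω => by positivity) (by positivity)
      push_cast
      have := hK n
      nlinarith [mul_nonneg (sq_nonneg (1 + K)) (Nat.cast_nonneg (α := ℝ) n)]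

lemma memLp_four {Ω : Type*} [MeasurableSpace Ω] {μ : Measure Ω} {f : Ω → ℝ} (hf : Measurable f)
    (h : Integrable (fun ω => f ω ^ 4) μ) : MemLp f 4 μ := by
  rw [← integrable_norm_rpow_iff hf.aestronglyMeasurable (by norm_num) (by norm_num)]
  refine h.congr (ae_of_all _ fun ω => ?_)
  have : (4 : ℝ≥0∞).toReal = ((4 : ℕ) : ℝ) := by norm_num
  simp only [this, Real.rpow_natCast, Real.norm_eq_abs]
  exact (Even.pow_abs (by decide) _).symm

lemma integrable_pow_four {Ω : Type*} [MeasurableSpace Ω] {μ : Measure Ω} {f : Ω → ℝ}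
    (hf : MemLp f 4 μ) : Integrable (fun ω => f ω ^ 4) μ := by
  have := MemLp.integrable_norm_pow (p := 4) (by exact_mod_cast hf) (by norm_num)
  refine this.congr (ae_of_all _ fun ω => ?_)
  simp only [Real.norm_eq_abs]
  exact (Even.pow_abs (by decide) _)

lemma abs_mean_le {Ω : Type*} [MeasurableSpace Ω] (μ : Measure Ω) [IsProbabilityMeasure μ]
    {f : Ω → ℝ} (hf : Measurable f) (h4 : Integrable (fun ω => f ω ^ 4) μ) (κ : ℝ)
    (hκ : ∫ ω, f ω ^ 4 ∂μ ≤ κ) : |∫ ω, f ω ∂μ| ≤ 1 + κ := by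
  have h1 : Integrable f μ := (memLp_four hf h4).integrable (by norm_num)
  calc |∫ ω, f ω ∂μ| ≤ ∫ ω, |f ω| ∂μ := abs_integral_le_integral_abs
    _ ≤ ∫ ω, (1 + f ω ^ 4) ∂μ := by
        apply integral_mono h1.abs ((integrable_const _).fun_add h4)
        intro ω
        show |f ω| ≤ 1 + f ω ^ 4
        have := Even.pow_abs (n := 4) (by decide) (f ω)
        rw [← this]
        have h0 := abs_nonneg (f ω)
        nlinarith [sq_nonneg (|f ω| - 1), sq_nonneg (|f ω| ^ 2 - 1)]
    _ = 1 + ∫ ω, f ω ^ 4 ∂μ := by rw [integral_add (integrable_const _) h4]; simp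
    _ ≤ _ := by linarith

lemma slln_lindep {Ω : Type*} [MeasurableSpace Ω] (μ : Measure Ω) [IsProbabilityMeasure μ]
    (ℓ : ℕ) (hℓ : 0 < ℓ) (X : ℕ → Ω → ℝ) (κ : ℝ) (hXm : ∀ i, Measurable (X i))
    (hX : LIndepSeq ℓ X μ) (h4 : ∀ i, Integrable (fun ω => X i ω ^ 4) μ)
    (hκ : ∀ i, ∫ ω, X i ω ^ 4 ∂μ ≤ κ) :
    ∀ᵐ ω ∂μ, Tendsto (fun n : ℕ => (n : ℝ)⁻¹ * ∑ i ∈ Finset.range n, (X i ω - ∫ ω', X i ω' ∂μ))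
      atTop (𝓝 0) := by
  set c : ℕ → ℝ := fun i => ∫ ω', X i ω' ∂μ with hc
  have hL : ∀ i, MemLp (X i) 4 μ := fun i => memLp_four (hXm i) (h4 i)
  have hκ0 : 0 ≤ κ := (integral_nonneg (fun ω => by positivity)).trans (hκ 0)
  have hcb : ∀ i, |c i| ≤ 1 + κ := fun i => abs_mean_le μ (hXm i) (h4 i) κ (hκ i)
  have hZ : ∀ i, MemLp (fun ω => X i ω - c i) 4 μ := fun i => (hL i).sub (memLp_const _)
  set K := 8 * (κ + (1 + κ) ^ 4) with hKdef
  have hK0 : 0 ≤ K := by positivity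
  have hZ4 : ∀ i, ∫ ω, (X i ω - c i) ^ 4 ∂μ ≤ K := by
    intro i
    have hq : ∀ x y : ℝ, (x - y) ^ 4 ≤ 8 * (x ^ 4 + y ^ 4) := by
      intro x y
      have := sq_nonneg (x + y)
      have h2 : (x - y) ^ 2 ≤ 2 * (x ^ 2 + y ^ 2) := by nlinarith
      have h3 : ((x - y) ^ 2) ^ 2 ≤ (2 * (x ^ 2 + y ^ 2)) ^ 2 := by gcongr
      nlinarith [sq_nonneg (x ^ 2 - y ^ 2)]
    have hc4 : c i ^ 4 ≤ (1 + κ) ^ 4 := by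
      rw [← Even.pow_abs (n := 4) (by decide) (c i)]
      exact pow_le_pow_left₀ (abs_nonneg _) (hcb i) 4
    calc ∫ ω, (X i ω - c i) ^ 4 ∂μ ≤ ∫ ω, 8 * (X i ω ^ 4 + c i ^ 4) ∂μ :=
          integral_mono (integrable_pow_four (hZ i))
            (((h4 i).fun_add (integrable_const _)).const_mul 8) (fun ω => hq _ _)
      _ = 8 * (∫ ω, X i ω ^ 4 ∂μ + c i ^ 4) := by
          rw [integral_const_mul, integral_add (h4 i) (integrable_const _)]; simp
      _ ≤ K := by linarith [hκ i]
  let U : ℕ → ℕ → Ω → ℝ := fun r i ω => if i % ℓ = r then X i ω - c i else 0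
  have hUm : ∀ r i, Measurable (U r i) := by
    intro r i
    by_cases h : i % ℓ = r
    · simp only [U, h, if_true]; exact (hXm i).sub_const _
    · simp only [U, h, if_false]; exact measurable_const
  have main : ∀ r, ∀ᵐ ω ∂μ, Tendsto (fun n : ℕ => (n : ℝ)⁻¹ * ∑ i ∈ Finset.range n, U r i ω)
      atTop (𝓝 0) := by
    intro r
    have hU : ∀ i, MemLp (U r i) 4 μ := by
      intro i
      by_cases h : i % ℓ = r
      · simp only [U, h, if_true]; exact hZ i
      · simp only [U, h, if_false]; exact memLp_const _
    have hU0 : ∀ i, ∫ ω, U r i ω ∂μ = 0 := by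
      intro i
      by_cases h : i % ℓ = r
      · simp only [U, h, if_true]
        rw [integral_sub ((hL i).integrable (by norm_num)) (integrable_const _)]; simp [hc]
      · simp [U, h]
    have hU4 : ∀ i, ∫ ω, U r i ω ^ 4 ∂μ ≤ K := by
      intro i
      by_cases h : i % ℓ = r
      · simp only [U, h, if_true]; exact hZ4 i
      · simpa [U, h] using hK0
    have hind : ∀ n, IndepFun (fun ω => ∑ i ∈ Finset.range n, U r i ω) (U r n) μ := by
      intro n
      by_cases h : n % ℓ = r
      · let φ : ({k : ℕ // ℓ ≤ ((n : ℤ) - (k : ℤ)).natAbs} → ℝ) → ℝ := fun v =>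
          ∑ i ∈ Finset.range n, if h : ℓ ≤ ((n : ℤ) - (i : ℤ)).natAbs then
            (if i % ℓ = r then v ⟨i, h⟩ - c i else 0) else 0
        have hφ : Measurable φ := by
          apply Finset.measurable_fun_sum
          intro i _
          split_ifs <;> fun_prop
        have h1 := ((hX n).symm).comp hφ (ψ := fun x : ℝ => x - c n) (by fun_prop)
        convert h1 using 1
        · ext ω
          simp only [φ, Function.comp, U]
          apply Finset.sum_congr rfl
          intro i hi
          rw [Finset.mem_range] at hi
          by_cases hir : i % ℓ = r
          · have hd : ℓ ∣ n - i := (Nat.modEq_iff_dvd' hi.le).1 (hir.trans h.symm)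
            have hle := Nat.le_of_dvd (by omega) hd
            rw [dif_pos (by omega)]
          · simp [hir]
        · ext ω; simp [U, h]
      · have : U r n = fun _ => 0 := by ext ω; simp [U, h]
        rw [this]
        exact indepFun_const_right _ _
    have hb := fourth_bound μ (U r) hU hU0 K hU4 hind
    refine ae_tendsto_of_four μ _ (fun n ω => ENNReal.ofReal ((∑ i ∈ Finset.range n, U r i ω) ^ 4))
      ?_ (7 * (1 + K) ^ 2) ?_ (fun n ω => le_rfl)
    · intro n
      exact ((Finset.measurable_fun_sum _ (fun i _ => hUm r i)).pow_const 4).ennreal_ofReal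
    · intro n
      rw [← ofReal_integral_eq_lintegral_ofReal (integrable_pow_four (hb n).1)
        (ae_of_all _ fun ω => by positivity)]
      exact ENNReal.ofReal_le_ofReal (hb n).2.2.2
  rw [← ae_all_iff] at main
  filter_upwards [main] with ω hω
  have h1 := tendsto_finsetSum (Finset.range ℓ) (fun r _ => hω r)
  simp only [Finset.sum_const_zero] at h1
  refine h1.congr fun n => ?_
  rw [← Finset.mul_sum, Finset.sum_comm]
  congr 1
  apply Finset.sum_congr rfl
  intro i _
  simp [U, hc, Finset.sum_ite_eq, Nat.mod_lt i hℓ]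

lemma ae_const_of_zero {Ω : Type*} [MeasurableSpace Ω] (μ : Measure Ω) [IsProbabilityMeasure μ]
    (X : ℕ → Ω → ℝ) (hXm : ∀ i, Measurable (X i)) (hX : LIndepSeq 0 X μ) (t : ℕ) :
    ∃ c : ℝ, ∀ᵐ ω ∂μ, X t ω = c := by
  have h1 : IndepFun (X t) (X t) μ :=
    (hX t).comp (φ := id)
      (ψ := fun v : ({k : ℕ // 0 ≤ ((t : ℤ) - (k : ℤ)).natAbs} → ℝ) => v ⟨t, Nat.zero_le _⟩)
      measurable_id (by fun_prop)
  refine exists_eventuallyEq_const_of_forall_separating (l := ae μ) (f := X t) MeasurableSet ?_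
  intro U hU
  have h2 := measure_eq_zero_or_one_of_indep_self (m := MeasurableSpace.comap (X t) inferInstance)
    (μ := μ) h1 ⟨U, hU, rfl⟩
  rcases h2 with h | h
  · right; exact measure_eq_zero_iff_ae_notMem.1 h
  · left; exact (mem_ae_iff_prob_eq_one (hXm t hU)).2 h

lemma meas_permStat {Ω : Type*} {m : MeasurableSpace Ω} {X Y : ℕ → Ω → ℝ}
    (hX : ∀ i, Measurable (X i)) (hY : ∀ i, Measurable (Y i)) (n : ℕ) (e : Equiv.Perm (Fin n)) :
    Measurable (fun ω => ENNReal.ofReal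
      (permStat (fun i : Fin n => X i ω) (fun i : Fin n => Y i ω) e ^ 4)) := by
  unfold permStat
  fun_prop

lemma perm_part {Ω : Type*} (m : MeasurableSpace Ω) [mΩ : MeasurableSpace Ω] (μ : Measure Ω)
    [IsProbabilityMeasure μ] (X Y : ℕ → Ω → ℝ) (K : ℝ) (hmle : m ≤ mΩ)
    (hXm : ∀ i, Measurable[m] (X i)) (hYm : ∀ i, Measurable[m] (Y i))
    (hint : ∀ i j, Integrable (fun ω => X i ω ^ 4 * Y j ω ^ 4) μ)
    (hK : ∀ i j, ∫ ω, X i ω ^ 4 * Y j ω ^ 4 ∂μ ≤ K)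
    (σ : (n : ℕ) → Ω → Equiv.Perm (Fin n))
    (hσunif : ∀ n, IsUniformPerm (σ n) μ)
    (hσdata : Indep (⨆ n, MeasurableSpace.comap (σ n) ⊤) m μ) :
    ∀ᵐ ω ∂μ, Tendsto
      (fun n : ℕ => (n : ℝ)⁻¹ *
        permStat (fun i : Fin n => X i ω) (fun i : Fin n => Y i ω) (σ n ω)) atTop (𝓝 0) := by
  have hXmeas : ∀ i, Measurable (X i) := fun i => (hXm i).mono hmle le_rfl
  have hYmeas : ∀ i, Measurable (Y i) := fun i => (hYm i).mono hmle le_rfl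
  let g : (n : ℕ) → Equiv.Perm (Fin n) → Ω → ℝ := fun n e ω =>
    permStat (fun i : Fin n => X i ω) (fun i : Fin n => Y i ω) e
  let A : (n : ℕ) → Equiv.Perm (Fin n) → Set Ω := fun n e => toMeasurable μ {ω | σ n ω = e}
  have hA : ∀ n e, MeasurableSet (A n e) := fun n e => measurableSet_toMeasurable _ _
  have hgm : ∀ n e, Measurable[m] (fun ω => ENNReal.ofReal (g n e ω ^ 4)) := fun n e =>
    meas_permStat hXm hYm n e
  have hgm' : ∀ n e, Measurable (fun ω => ENNReal.ofReal (g n e ω ^ 4)) := fun n e =>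
    meas_permStat hXmeas hYmeas n e
  let G : ℕ → Ω → ℝ≥0∞ := fun n ω => ∑ e : Equiv.Perm (Fin n),
    ENNReal.ofReal (g n e ω ^ 4) * (A n e).indicator (fun _ => 1) ω
  have hterm : ∀ n e, Measurable (fun ω =>
      ENNReal.ofReal (g n e ω ^ 4) * (A n e).indicator (fun _ => 1) ω) := fun n e =>
    (hgm' n e).mul (measurable_const.indicator (hA n e))
  refine ae_tendsto_of_four μ _ G (fun n => Finset.measurable_fun_sum _ fun e _ => hterm n e)
    (144 * K) ?_ ?_
  · intro n
    have hone : ∀ e, ∫⁻ ω, ENNReal.ofReal (g n e ω ^ 4) * (A n e).indicator (fun _ => 1) ω ∂μ =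
        (∫⁻ ω, ENNReal.ofReal (g n e ω ^ 4) ∂μ) * (Nat.factorial n : ℝ≥0∞)⁻¹ := by
      intro e
      rw [lintegral_mul_indicator_eq_lintegral_mul_lintegral_indicator hmle 1 (hA n e) ?_ (hgm n e)]
      · congr 1
        rw [lintegral_indicator_const (hA n e), measure_toMeasurable, hσunif n e, one_mul]
      · rw [IndepSets_iff]
        intro s t hs ht
        rw [Set.mem_singleton_iff] at ht
        subst ht
        have hs' : MeasurableSet s := hmle s hs
        have hσm : MeasurableSet[⨆ n, MeasurableSpace.comap (σ n) ⊤] {ω | σ n ω = e} :=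
          (le_iSup (fun n => MeasurableSpace.comap (σ n) ⊤) n) _ ⟨{e}, trivial, rfl⟩
        have := (Indep_iff _ _ μ).1 hσdata _ s hσm hs
        rw [Set.inter_comm, Measure.measure_toMeasurable_inter hs' (measure_ne_top _ _), this,
          measure_toMeasurable, mul_comm]
    have hW : ∀ (e : Equiv.Perm (Fin n)) (I J : Fin n),
        Integrable (fun ω => (X I ω ^ 4 + X J ω ^ 4) * (Y (e I) ω ^ 4 + Y (e J) ω ^ 4)) μ ∧
        ∫ ω, (X I ω ^ 4 + X J ω ^ 4) * (Y (e I) ω ^ 4 + Y (e J) ω ^ 4) ∂μ ≤ 4 * K := by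
      intro e I J
      have h1 := hint I (e I)
      have h2 := hint I (e J)
      have h3 := hint J (e I)
      have h4 := hint J (e J)
      have : ∀ ω, (X I ω ^ 4 + X J ω ^ 4) * (Y (e I) ω ^ 4 + Y (e J) ω ^ 4) =
        X I ω ^ 4 * Y (e I) ω ^ 4 + X I ω ^ 4 * Y (e J) ω ^ 4 + X J ω ^ 4 * Y (e I) ω ^ 4
          + X J ω ^ 4 * Y (e J) ω ^ 4 := by intro ω; ring
      simp only [this]
      refine ⟨((h1.fun_add h2).fun_add h3).fun_add h4, ?_⟩
      rw [integral_add ((h1.fun_add h2).fun_add h3) h4, integral_add (h1.fun_add h2) h3,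
        integral_add h1 h2]
      linarith [hK I (e I), hK I (e J), hK J (e I), hK J (e J)]
    let Q : Ω → ℝ := fun ω => 36 * ∑ e : Equiv.Perm (Fin n), ∑ I : Fin n, ∑ J : Fin n,
      (X I ω ^ 4 + X J ω ^ 4) * (Y (e I) ω ^ 4 + Y (e J) ω ^ 4)
    have hQi : Integrable Q μ := (integrable_finsetSum _ fun e _ => integrable_finsetSum _ fun I _ =>
      integrable_finsetSum _ fun J _ => (hW e I J).1).const_mul 36
    have hQ : ∫ ω, Q ω ∂μ ≤ (144 * K * n ^ 2) * n.factorial := by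
      have : ∫ ω, Q ω ∂μ = 36 * ∑ e : Equiv.Perm (Fin n), ∑ I : Fin n, ∑ J : Fin n,
          ∫ ω, (X I ω ^ 4 + X J ω ^ 4) * (Y (e I) ω ^ 4 + Y (e J) ω ^ 4) ∂μ := by
        simp only [Q]
        rw [integral_const_mul, integral_finsetSum _ fun e _ => integrable_finsetSum _ fun I _ =>
          integrable_finsetSum _ fun J _ => (hW e I J).1]
        congr 1
        apply Finset.sum_congr rfl; intro e _
        rw [integral_finsetSum _ fun I _ => integrable_finsetSum _ fun J _ => (hW e I J).1]
        apply Finset.sum_congr rfl; intro I _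
        rw [integral_finsetSum _ fun J _ => (hW e I J).1]
      rw [this]
      calc _ ≤ 36 * ∑ e : Equiv.Perm (Fin n), ∑ I : Fin n, ∑ J : Fin n, 4 * K := by
            gcongr with e _ I _ J _
            exact (hW e I J).2
        _ = _ := by
            simp [Fintype.card_perm]; ring
    have hQ0 : ∀ ω, 0 ≤ Q ω := fun ω => by positivity
    calc ∫⁻ ω, G n ω ∂μ = ∑ e, (∫⁻ ω, ENNReal.ofReal (g n e ω ^ 4) ∂μ) * (Nat.factorial n : ℝ≥0∞)⁻¹ := by
          rw [lintegral_finsetSum _ fun e _ => hterm n e]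
          exact Finset.sum_congr rfl fun e _ => hone e
      _ = (∫⁻ ω, ENNReal.ofReal (∑ e, g n e ω ^ 4) ∂μ) * (Nat.factorial n : ℝ≥0∞)⁻¹ := by
          rw [← Finset.sum_mul, ← lintegral_finsetSum _ fun e _ => hgm' n e]
          congr 1
          apply lintegral_congr
          intro ω
          rw [ENNReal.ofReal_sum_of_nonneg]
          intro e _; positivity
      _ ≤ (∫⁻ ω, ENNReal.ofReal (Q ω) ∂μ) * (Nat.factorial n : ℝ≥0∞)⁻¹ := by
          gcongr with ω
          exact permStat_four (fun i : Fin n => X i ω) (fun i : Fin n => Y i ω)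
      _ ≤ ENNReal.ofReal ((144 * K * n ^ 2) * n.factorial) * (Nat.factorial n : ℝ≥0∞)⁻¹ := by
          rw [← ofReal_integral_eq_lintegral_ofReal hQi (ae_of_all _ hQ0)]
          gcongr
      _ = ENNReal.ofReal (144 * K * n ^ 2) := by
          rw [ENNReal.ofReal_mul' (by positivity), ENNReal.ofReal_natCast, mul_assoc,
            ENNReal.mul_inv_cancel, mul_one]
          · exact_mod_cast n.factorial_ne_zero
          · exact ENNReal.natCast_ne_top _
  · intro n ω
    have hmem : ω ∈ A n (σ n ω) := subset_toMeasurable μ _ rfl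
    have := Finset.single_le_sum (f := fun e : Equiv.Perm (Fin n) =>
      ENNReal.ofReal (g n e ω ^ 4) * (A n e).indicator (fun _ => (1 : ℝ≥0∞)) ω)
      (fun _ _ => zero_le) (Finset.mem_univ (σ n ω))
    simp only [Set.indicator_of_mem hmem, mul_one] at this
    exact this

lemma tendsto_prod_aux (x y m : ℕ → ℝ) (C : ℝ) (hx : Tendsto x atTop (𝓝 0))
    (hy : Tendsto (fun n => y n - m n) atTop (𝓝 0)) (hm : ∀ n, |m n| ≤ C) :
    Tendsto (fun n => x n * y n) atTop (𝓝 0) := by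
  have h1 := hx.mul hy
  have h2 : Tendsto (fun n => x n * m n) atTop (𝓝 0) :=
    Filter.Tendsto.zero_mul_isBoundedUnder_le hx
      ⟨C, eventually_map.2 (Eventually.of_forall (fun n => by simpa using hm n))⟩
  have := h1.add h2
  simp only [mul_zero, add_zero] at this
  refine this.congr fun n => ?_
  ring

lemma mean_bdd (c : ℕ → ℝ) (B : ℝ) (hc : ∀ i, |c i| ≤ B) (n : ℕ) :
    |(n : ℝ)⁻¹ * ∑ i ∈ Finset.range n, c i| ≤ B := by
  have hB : 0 ≤ B := (abs_nonneg _).trans (hc 0)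
  rcases Nat.eq_zero_or_pos n with rfl | hn
  · simpa using hB
  have hn' : (0 : ℝ) < n := by positivity
  rw [abs_mul, abs_of_pos (inv_pos.2 hn'), inv_mul_le_iff₀ hn']
  calc |∑ i ∈ Finset.range n, c i| ≤ ∑ i ∈ Finset.range n, |c i| := Finset.abs_sum_le_sum_abs _ _
    _ ≤ ∑ i ∈ Finset.range n, B := Finset.sum_le_sum fun i _ => hc i
    _ = n * B := by simp

/-- **Permutation SLLN (Lemma 1).**  If `{X_i}` and `{Y_i}` are `ℓ`-independent
sequences with the stated cross moment bounds, far cross-independence and zero far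
cross-correlations, and `σ_n` are uniform random permutations of `{0,…,n-1}`,
independent of each other and of the two sequences, then
`(1/n) ∑_{i<n} X_i Y_{σ_n(i)} → 0` almost surely. -/
theorem residual_permuted_slln
    {Ω : Type*} [MeasurableSpace Ω] (μ : Measure Ω) [IsProbabilityMeasure μ]
    (ℓ : ℕ) (X Y : ℕ → Ω → ℝ) (κ₀ : ℝ)
    (hXmeas : ∀ i, Measurable (X i)) (hYmeas : ∀ i, Measurable (Y i))
    (hX : LIndepSeq ℓ X μ) (hY : LIndepSeq ℓ Y μ)
    (hmom : ∀ i j : ℕ, ((j : ℤ) - (i : ℤ)).natAbs < ℓ →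
      ∀ a b : ℕ, a ≤ 4 → b ≤ 4 → (a = b ∨ a + b ≤ 4) →
      Integrable (fun ω => X i ω ^ a * Y j ω ^ b) μ ∧
        ∫ ω, X i ω ^ a * Y j ω ^ b ∂μ ≤ κ₀)
    (hfar_indep : ∀ i j : ℕ, ℓ ≤ ((j : ℤ) - (i : ℤ)).natAbs → IndepFun (X i) (Y j) μ)
    (hfar_zero : ∀ i j : ℕ, ℓ ≤ ((j : ℤ) - (i : ℤ)).natAbs →
      ∫ ω, X i ω * Y j ω ∂μ = 0)
    (σ : (n : ℕ) → Ω → Equiv.Perm (Fin n))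
    (hσunif : ∀ n, IsUniformPerm (σ n) μ)
    (hσindep : iIndep (fun n => MeasurableSpace.comap (σ n) ⊤) μ)
    (hσdata : Indep (⨆ n, MeasurableSpace.comap (σ n) ⊤)
      ((⨆ i, MeasurableSpace.comap (X i) inferInstance) ⊔
        ⨆ i, MeasurableSpace.comap (Y i) inferInstance) μ) :
    ∀ᵐ ω ∂μ, Tendsto
      (fun n : ℕ => (n : ℝ)⁻¹ * ∑ i : Fin n, X (i : ℕ) ω * Y ((σ n ω i : Fin n) : ℕ) ω)
      atTop (𝓝 0) := by
  rcases Nat.eq_zero_or_pos ℓ with rfl | hℓ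
  · choose c hc using ae_const_of_zero μ X hXmeas hX
    choose d hd using ae_const_of_zero μ Y hYmeas hY
    have hcd : ∀ i j, c i * d j = 0 := by
      intro i j
      have h1 := hfar_zero i j (Nat.zero_le _)
      have h2 : ∫ ω, X i ω * Y j ω ∂μ = ∫ _, c i * d j ∂μ := by
        apply integral_congr_ae
        filter_upwards [hc i, hd j] with ω h3 h4
        rw [h3, h4]
      rw [h1] at h2
      simpa using h2.symm
    filter_upwards [ae_all_iff.2 hc, ae_all_iff.2 hd] with ω h1 h2
    simp [h1, h2, hcd]
  have hX4 : ∀ i, Integrable (fun ω => X i ω ^ 4) μ ∧ ∫ ω, X i ω ^ 4 ∂μ ≤ κ₀ := by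
    intro i
    simpa using hmom i i (by simpa using hℓ) 4 0 (by norm_num) (by norm_num) (by norm_num)
  have hY4 : ∀ i, Integrable (fun ω => Y i ω ^ 4) μ ∧ ∫ ω, Y i ω ^ 4 ∂μ ≤ κ₀ := by
    intro i
    simpa using hmom i i (by simpa using hℓ) 0 4 (by norm_num) (by norm_num) (by norm_num)
  have hκ0 : 0 ≤ κ₀ := (integral_nonneg (fun ω => by positivity)).trans (hX4 0).2
  have hXY : ∀ i j, Integrable (fun ω => X i ω ^ 4 * Y j ω ^ 4) μ ∧
      ∫ ω, X i ω ^ 4 * Y j ω ^ 4 ∂μ ≤ κ₀ + κ₀ * κ₀ := by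
    intro i j
    by_cases h : ((j : ℤ) - (i : ℤ)).natAbs < ℓ
    · have := hmom i j h 4 4 le_rfl le_rfl (Or.inl rfl)
      exact ⟨this.1, this.2.trans (le_add_of_nonneg_right (by positivity))⟩
    · have hh : IndepFun (fun ω => X i ω ^ 4) (fun ω => Y j ω ^ 4) μ :=
        (hfar_indep i j (not_lt.1 h)).comp (φ := fun x : ℝ => x ^ 4) (ψ := fun x : ℝ => x ^ 4)
          (by fun_prop) (by fun_prop)
      refine ⟨hh.integrable_mul (hX4 i).1 (hY4 j).1, ?_⟩
      rw [hh.integral_fun_mul_eq_mul_integral (hX4 i).1.1 (hY4 j).1.1]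
      have := mul_le_mul (hX4 i).2 (hY4 j).2 (integral_nonneg (fun ω => by positivity)) hκ0
      exact this.trans (le_add_of_nonneg_left hκ0)
  have hP := perm_part _ μ X Y (κ₀ + κ₀ * κ₀)
    (sup_le (iSup_le fun i => (hXmeas i).comap_le) (iSup_le fun i => (hYmeas i).comap_le))
    (fun i => measurable_iff_comap_le.2
      ((le_iSup (fun i => MeasurableSpace.comap (X i) inferInstance) i).trans le_sup_left))
    (fun i => measurable_iff_comap_le.2
      ((le_iSup (fun i => MeasurableSpace.comap (Y i) inferInstance) i).trans le_sup_right))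
    (fun i j => (hXY i j).1)
    (fun i j => (hXY i j).2) σ hσunif hσdata
  have hSX := slln_lindep μ ℓ hℓ X κ₀ hXmeas hX (fun i => (hX4 i).1) (fun i => (hX4 i).2)
  have hSY := slln_lindep μ ℓ hℓ Y κ₀ hYmeas hY (fun i => (hY4 i).1) (fun i => (hY4 i).2)
  have hcX : ∀ i, |∫ ω, X i ω ∂μ| ≤ 1 + κ₀ := fun i => abs_mean_le μ (hXmeas i) (hX4 i).1 κ₀ (hX4 i).2
  have hcY : ∀ i, |∫ ω, Y i ω ∂μ| ≤ 1 + κ₀ := fun i => abs_mean_le μ (hYmeas i) (hY4 i).1 κ₀ (hY4 i).2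
  have hprod : ∀ i j : ℕ, ℓ ≤ ((j : ℤ) - (i : ℤ)).natAbs →
      (∫ ω, X i ω ∂μ) * ∫ ω, Y j ω ∂μ = 0 := by
    intro i j h
    rw [← (hfar_indep i j h).integral_fun_mul_eq_mul_integral (hXmeas i).aestronglyMeasurable
      (hYmeas j).aestronglyMeasurable, hfar_zero i j h]
  filter_upwards [hP, hSX, hSY] with ω h1 h2 h3
  simp only [Finset.sum_sub_distrib, mul_sub] at h2 h3
  have h4 : Tendsto (fun n : ℕ => ((n : ℝ)⁻¹ * ∑ i ∈ Finset.range n, X i ω) *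
      ((n : ℝ)⁻¹ * ∑ i ∈ Finset.range n, Y i ω)) atTop (𝓝 0) := by
    by_cases hz : ∀ i, ∫ ω, X i ω ∂μ = 0
    · refine tendsto_prod_aux _ _ _ (1 + κ₀) ?_ h3 (mean_bdd _ _ hcY)
      simpa [hz] using h2
    · push Not at hz
      obtain ⟨i₀, hi₀⟩ := hz
      have hYz : ∀ j, i₀ + ℓ ≤ j → ∫ ω, Y j ω ∂μ = 0 := by
        intro j hj
        exact (mul_eq_zero.1 (hprod i₀ j (by omega))).resolve_left hi₀
      have hmY : Tendsto (fun n : ℕ => (n : ℝ)⁻¹ * ∑ i ∈ Finset.range n, ∫ ω, Y i ω ∂μ)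
          atTop (𝓝 0) := by
        have h5 : Tendsto (fun n : ℕ => (n : ℝ)⁻¹ * ∑ i ∈ Finset.range (i₀ + ℓ), ∫ ω, Y i ω ∂μ)
            atTop (𝓝 0) := by
          simpa using (tendsto_inv_atTop_nhds_zero_nat (𝕜 := ℝ)).mul_const
            (∑ i ∈ Finset.range (i₀ + ℓ), ∫ ω, Y i ω ∂μ)
        refine h5.congr' ?_
        filter_upwards [eventually_ge_atTop (i₀ + ℓ)] with n hn
        congr 1
        apply Finset.sum_subset (Finset.range_subset_range.2 hn)
        intro j _ hj
        exact hYz j (by simpa using hj)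
      have hYb : Tendsto (fun n : ℕ => (n : ℝ)⁻¹ * ∑ i ∈ Finset.range n, Y i ω) atTop (𝓝 0) := by
        simpa using h3.add hmY
      have := tendsto_prod_aux _ _ _ (1 + κ₀) hYb h2 (mean_bdd _ _ hcX)
      exact this.congr fun n => mul_comm _ _
  have h5 := h1.add h4
  simp only [add_zero] at h5
  refine h5.congr fun n => ?_
  rw [← Fin.sum_univ_eq_sum_range (fun i => X i ω), ← Fin.sum_univ_eq_sum_range (fun i => Y i ω)]
  unfold permStat
  ring

end
end

section
/- Let {Z_t}_{t≥1} be an ℓ-independent sequence of real random variables with E[Z_t] = 0 and E[Z_t^4] ≤ κ < ∞ for all t. Then (1/n) ∑_{t=1}^{n} Z_t → 0 almost surely as n → ∞. -/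
open MeasureTheory ProbabilityTheory Filter
open scoped ENNReal NNReal Topology

noncomputable section

lemma aux_tendsto {Ω : Type*} [MeasurableSpace Ω] (μ : Measure Ω) (g : ℕ → Ω → ℝ) (b : ℕ → ℝ)
    (hm : ∀ k, Measurable (g k)) (h0 : ∀ k ω, 0 ≤ g k ω) (hi : ∀ k, Integrable (g k) μ)
    (hb : ∀ k, ∫ ω, g k ω ∂μ ≤ b k) (hs : Summable b) :
    ∀ᵐ ω ∂μ, Tendsto (fun k => g k ω) atTop (𝓝 0) := by
  have hb0 : ∀ k, 0 ≤ b k := fun k => (integral_nonneg (h0 k)).trans (hb k)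
  have h1 : ∫⁻ ω, ∑' k, ENNReal.ofReal (g k ω) ∂μ ≠ ∞ := by
    rw [lintegral_tsum (fun k => (hm k).ennreal_ofReal.aemeasurable)]
    have h2 : ∀ k, ∫⁻ ω, ENNReal.ofReal (g k ω) ∂μ ≤ ENNReal.ofReal (b k) := fun k => by
      rw [← ofReal_integral_eq_lintegral_ofReal (hi k) (Eventually.of_forall (h0 k))]
      exact ENNReal.ofReal_le_ofReal (hb k)
    refine ne_top_of_le_ne_top ?_ (ENNReal.tsum_le_tsum h2)
    exact hs.tsum_ofReal_ne_top
  filter_upwards [ae_lt_top (Measurable.tsum fun k => (hm k).ennreal_ofReal) h1] with ω hω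
  have h3 := ENNReal.tendsto_atTop_zero_of_tsum_ne_top hω.ne
  have h4 := (ENNReal.tendsto_toReal ENNReal.zero_ne_top).comp h3
  simpa [Function.comp_def, ENNReal.toReal_ofReal (h0 _ _)] using h4

lemma aux_det (z : ℕ → ℝ)
    (h : Tendsto (fun k : ℕ => ((∑ t ∈ Finset.range (k^2), z t)^2
      + (∑ t ∈ Finset.Ico (k^2) ((k+1)^2), |z t|)^2) / (k:ℝ)^4) atTop (𝓝 0)) :
    Tendsto (fun n : ℕ => (n : ℝ)⁻¹ * ∑ t ∈ Finset.range n, z t) atTop (𝓝 0) := by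
  have hsq : Tendsto Nat.sqrt atTop atTop := by
    refine tendsto_atTop.2 fun b => ?_
    filter_upwards [eventually_ge_atTop (b*b)] with n hn
    exact Nat.le_sqrt.2 hn
  have h2 := ((h.comp hsq).const_mul 2).sqrt
  simp only [mul_zero, Real.sqrt_zero] at h2
  refine squeeze_zero_norm' ?_ h2
  filter_upwards [eventually_ge_atTop 1] with n hn
  rw [Real.norm_eq_abs]
  apply Real.abs_le_sqrt
  simp only [Function.comp]
  set k := Nat.sqrt n with hk
  have hk1 : 1 ≤ k := Nat.le_sqrt.2 (by simpa using hn)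
  have hkn : k^2 ≤ n := Nat.sqrt_le' n
  have hkn2 : n < (k+1)^2 := Nat.lt_succ_sqrt' n
  have e : ∑ t ∈ Finset.range n, z t
      = ∑ t ∈ Finset.range (k^2), z t + ∑ t ∈ Finset.Ico (k^2) n, z t :=
    (Finset.sum_range_add_sum_Ico z hkn).symm
  have hD : |∑ t ∈ Finset.Ico (k^2) n, z t| ≤ ∑ t ∈ Finset.Ico (k^2) ((k+1)^2), |z t| :=
    (Finset.abs_sum_le_sum_abs _ _).trans
      (Finset.sum_le_sum_of_subset_of_nonneg (Finset.Ico_subset_Ico_right hkn2.le)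
        (fun _ _ _ => abs_nonneg _))
  have hD2 := sq_le_sq' (by linarith [neg_abs_le (∑ t ∈ Finset.Ico (k^2) n, z t), abs_nonneg (∑ t ∈ Finset.Ico (k^2) n, z t)]) hD
  rw [sq_abs] at hD2
  have hkR : (0:ℝ) < k := by exact_mod_cast hk1
  have hnR : (k:ℝ)^2 ≤ n := by exact_mod_cast hkn
  have hn4 : (k:ℝ)^4 ≤ (n:ℝ)^2 := by nlinarith [sq_nonneg (k:ℝ)]
  rw [e, mul_pow, inv_pow, inv_mul_eq_div, mul_div_assoc']
  apply div_le_div₀ (by positivity) _ (by positivity) hn4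
  nlinarith [sq_nonneg (∑ t ∈ Finset.range (k^2), z t - ∑ t ∈ Finset.Ico (k^2) n, z t)]

/-- **SLLN for `ℓ`-independent sequences.**  If `{Z_t}` is an `ℓ`-independent
sequence of real random variables with `E[Z_t] = 0` and `E[Z_t^4] ≤ κ < ∞` for all
`t`, then `(1/n) ∑_{t<n} Z_t → 0` almost surely. -/
theorem lIndep_fourth_moment_slln
    {Ω : Type*} [MeasurableSpace Ω] (μ : Measure Ω) [IsProbabilityMeasure μ]
    (ℓ : ℕ) (κ : ℝ) (Z : ℕ → Ω → ℝ)
    (hZmeas : ∀ t, Measurable (Z t))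
    (hZLindep : LIndepSeq ℓ Z μ)
    (hZmean : ∀ t, ∫ ω, Z t ω ∂μ = 0)
    (hZ4 : ∀ t, Integrable (fun ω => Z t ω ^ 4) μ ∧ ∫ ω, Z t ω ^ 4 ∂μ ≤ κ) :
    ∀ᵐ ω ∂μ, Tendsto
      (fun n : ℕ => (n : ℝ)⁻¹ * ∑ t ∈ Finset.range n, Z t ω) atTop (𝓝 0) := by
  have hle : ∀ x : ℝ, x^2 ≤ 1 + x^4 := fun x => by nlinarith [sq_nonneg (x^2-1), sq_nonneg (x^2)]
  have hi2 : ∀ t, Integrable (fun ω => Z t ω ^ 2) μ := fun t => by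
    refine ((integrable_const (1:ℝ)).add (hZ4 t).1).mono' ((hZmeas t).pow_const 2).aestronglyMeasurable ?_
    refine Eventually.of_forall fun ω => ?_
    rw [Real.norm_of_nonneg (sq_nonneg _)]
    exact hle _
  have hM : ∀ t, ∫ ω, Z t ω ^ 2 ∂μ ≤ 1 + κ := fun t => by
    have h := integral_mono (hi2 t) ((integrable_const (1:ℝ)).add (hZ4 t).1) (fun ω => hle (Z t ω))
    simp only [Pi.add_apply] at h
    rw [integral_add (integrable_const _) (hZ4 t).1] at h
    simp at h
    linarith [(hZ4 t).2]
  set M := 1 + κ with hMdef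
  have hM0 : 0 ≤ M := (integral_nonneg (fun ω => sq_nonneg (Z 0 ω))).trans (hM 0)
  have hL2 : ∀ t, MemLp (Z t) 2 μ := fun t =>
    (memLp_two_iff_integrable_sq (hZmeas t).aestronglyMeasurable).2 (hi2 t)
  have hprod : ∀ s t, Integrable (fun ω => Z s ω * Z t ω) μ := fun s t =>
    (hL2 s).integrable_mul (hL2 t)
  have hprodM : ∀ s t, ∫ ω, Z s ω * Z t ω ∂μ ≤ M := fun s t => by
    have h := integral_mono (hprod s t) (((hi2 s).add (hi2 t)).div_const 2) (fun ω => by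
      simp only [Pi.add_apply]
      nlinarith [sq_nonneg (Z s ω - Z t ω)])
    simp only [Pi.add_apply] at h
    rw [integral_div, integral_add (hi2 s) (hi2 t)] at h
    linarith [hM s, hM t]
  have horth : ∀ s t : ℕ, ℓ ≤ ((s:ℤ) - (t:ℤ)).natAbs → ∫ ω, Z s ω * Z t ω ∂μ = 0 := fun s t hst => by
    have hind : IndepFun (Z s) (Z t) μ :=
      (hZLindep s).comp (φ := id) 
        (ψ := fun f : {k : ℕ // ℓ ≤ ((s : ℤ) - (k : ℤ)).natAbs} → ℝ => f ⟨t, hst⟩) measurable_id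
        (measurable_pi_apply (⟨t, hst⟩ : {k : ℕ // ℓ ≤ ((s : ℤ) - (k : ℤ)).natAbs}))
    rw [hind.integral_fun_mul_eq_mul_integral (hZmeas s).aestronglyMeasurable
      (hZmeas t).aestronglyMeasurable, hZmean, zero_mul]
  have hSeq : ∀ (n : ℕ) (ω : Ω), (∑ t ∈ Finset.range n, Z t ω)^2
      = ∑ s ∈ Finset.range n, ∑ t ∈ Finset.range n, Z s ω * Z t ω := fun n ω => by
    rw [sq, Finset.sum_mul_sum]
  have hSi : ∀ n : ℕ, Integrable (fun ω => (∑ t ∈ Finset.range n, Z t ω)^2) μ := fun n => by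
    simp only [hSeq]
    exact integrable_finsetSum _ fun s _ => integrable_finsetSum _ fun t _ => hprod s t
  have hS : ∀ n : ℕ, ∫ ω, (∑ t ∈ Finset.range n, Z t ω)^2 ∂μ ≤ n * ((2*ℓ+1) * M) := fun n => by
    simp only [hSeq]
    rw [integral_finsetSum _ (fun s _ => integrable_finsetSum _ fun t _ => hprod s t)]
    have : ∀ s ∈ Finset.range n, ∫ ω, ∑ t ∈ Finset.range n, Z s ω * Z t ω ∂μ ≤ (2*ℓ+1) * M := by
      intro s _
      rw [integral_finsetSum _ (fun t _ => hprod s t)]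
      have h1 : ∀ t ∈ Finset.range n, ∫ ω, Z s ω * Z t ω ∂μ
          ≤ if t ∈ Finset.Icc (s-ℓ) (s+ℓ) then M else 0 := by
        intro t _
        split_ifs with h
        · exact hprodM s t
        · rw [horth s t]
          simp only [Finset.mem_Icc] at h
          omega
      refine (Finset.sum_le_sum h1).trans ?_
      rw [← Finset.sum_filter, Finset.sum_const, nsmul_eq_mul]
      refine mul_le_mul_of_nonneg_right ?_ hM0
      have h2 : (Finset.filter (fun t => t ∈ Finset.Icc (s-ℓ) (s+ℓ)) (Finset.range n)).card
          ≤ 2*ℓ+1 := by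
        refine (Finset.card_le_card (t := Finset.Icc (s-ℓ) (s+ℓ)) ?_).trans ?_
        · intro t ht
          exact (Finset.mem_filter.1 ht).2
        · rw [Nat.card_Icc]; omega
      exact_mod_cast h2
    refine (Finset.sum_le_sum this).trans ?_
    simp
  have hDle : ∀ (k : ℕ) (ω : Ω), (∑ t ∈ Finset.Ico (k^2) ((k+1)^2), |Z t ω|)^2
      ≤ (2*k+1) * ∑ t ∈ Finset.Ico (k^2) ((k+1)^2), Z t ω ^ 2 := fun k ω => by
    have h := sq_sum_le_card_mul_sum_sq (s := Finset.Ico (k^2) ((k+1)^2)) (f := fun t => |Z t ω|)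
    have hc : (k+1)^2 - k^2 = 2*k+1 := by
      have : (k+1)^2 = k^2 + (2*k+1) := by ring
      omega
    simp only [sq_abs, Nat.card_Ico, hc] at h
    exact_mod_cast h
  have hDm : ∀ k : ℕ, Measurable (fun ω => (∑ t ∈ Finset.Ico (k^2) ((k+1)^2), |Z t ω|)^2) :=
    fun k => (Finset.measurable_fun_sum _ fun t _ => (hZmeas t).abs).pow_const 2
  have hDbi : ∀ k : ℕ, Integrable (fun ω => (2*(k:ℝ)+1) * ∑ t ∈ Finset.Ico (k^2) ((k+1)^2), Z t ω ^ 2) μ :=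
    fun k => (integrable_finsetSum _ fun t _ => hi2 t).const_mul _
  have hDi : ∀ k : ℕ, Integrable (fun ω => (∑ t ∈ Finset.Ico (k^2) ((k+1)^2), |Z t ω|)^2) μ := fun k => by
    refine (hDbi k).mono' (hDm k).aestronglyMeasurable (Eventually.of_forall fun ω => ?_)
    rw [Real.norm_of_nonneg (sq_nonneg _)]
    exact hDle k ω
  have hD : ∀ k : ℕ, ∫ ω, (∑ t ∈ Finset.Ico (k^2) ((k+1)^2), |Z t ω|)^2 ∂μ ≤ (2*k+1)^2 * M := fun k => by
    refine (integral_mono (hDi k) (hDbi k) (hDle k)).trans ?_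
    rw [integral_const_mul, integral_finsetSum _ fun t _ => hi2 t, sq (2*(k:ℝ)+1), mul_assoc]
    refine mul_le_mul_of_nonneg_left ?_ (by positivity)
    refine (Finset.sum_le_sum fun t _ => hM t).trans ?_
    have hc : (k+1)^2 - k^2 = 2*k+1 := by
      have : (k+1)^2 = k^2 + (2*k+1) := by ring
      omega
    rw [Finset.sum_const, Nat.card_Ico, hc, nsmul_eq_mul]
    push_cast
    exact le_rfl
  have key := aux_tendsto μ (fun k ω => ((∑ t ∈ Finset.range (k^2), Z t ω)^2
      + (∑ t ∈ Finset.Ico (k^2) ((k+1)^2), |Z t ω|)^2) / (k:ℝ)^4)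
      (fun k => ((2*ℓ+1) * M + 9 * M) * (1 / (k:ℝ)^2))
      (fun k => (((Finset.measurable_fun_sum _ fun t _ => hZmeas t).pow_const 2).add (hDm k)).div_const _)
      (fun k ω => by positivity)
      (fun k => ((hSi _).add (hDi k)).div_const _)
      (fun k => by
        rw [integral_div, integral_add (hSi _) (hDi k)]
        rcases Nat.eq_zero_or_pos k with rfl | hk
        · simp
        have hk1 : (1:ℝ) ≤ k := by exact_mod_cast hk
        rw [div_le_iff₀ (by positivity)]
        have e : ((2*ℓ+1) * M + 9 * M) * (1 / (k:ℝ)^2) * (k:ℝ)^4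
          = (k:ℝ)^2 * ((2*ℓ+1) * M) + 9 * k^2 * M := by field_simp
        rw [e]
        have h1 := hS (k^2)
        push_cast at h1
        refine add_le_add h1 ((hD k).trans ?_)
        refine mul_le_mul_of_nonneg_right ?_ hM0
        nlinarith)
      ((Real.summable_one_div_nat_pow.2 one_lt_two).mul_left _)
  filter_upwards [key] with ω hω
  exact aux_det (fun t => Z t ω) hω


end
end

section
/- Let (Z_0, Z_1, …, Z_{m−1}) be an exchangeable family of real random variables and let π be a uniform random permutation of {0, …, m−1}, independent of (Z_0, …, Z_{m−1}). Define the tie-broken strict order Z_k ≻_π Z_j to hold if and only if (Z_k > Z_j) or (Z_k = Z_j and π(k) > π(j)), and define the rank R := 1 + #{i ∈ {1,…,m−1} : Z_0 ≻_π Z_i}. Then R is uniformly distributed on {1, …, m}; in particular, for any integer q with 0 < q < m, P(R ≤ m − q) = 1 − q/m. -/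
open MeasureTheory ProbabilityTheory Filter
open scoped ENNReal NNReal Topology

noncomputable section

instance (n : ℕ) : MeasurableSpace (Equiv.Perm (Fin n)) := ⊤

open scoped Classical

def rkBelow {m : ℕ} (z : Fin m → ℝ) (e : Equiv.Perm (Fin m)) (k i : Fin m) : Prop :=
  z k > z i ∨ (z k = z i ∧ e i < e k)

def rk {m : ℕ} (z : Fin m → ℝ) (e : Equiv.Perm (Fin m)) (k : Fin m) : ℕ :=
  (Finset.univ.filter (fun i => rkBelow z e k i)).card

lemma rk_lt {m : ℕ} (z : Fin m → ℝ) (e : Equiv.Perm (Fin m)) {k j : Fin m}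
    (h : rkBelow z e j k) : rk z e k < rk z e j := by
  unfold rk
  apply Finset.card_lt_card
  rw [Finset.ssubset_iff_of_subset]
  · refine ⟨k, by simpa using h, ?_⟩
    simp [rkBelow]
  · intro i
    simp only [Finset.mem_filter, Finset.mem_univ, true_and]
    unfold rkBelow at *
    intro hi
    rcases h with h | ⟨h, h'⟩ <;> rcases hi with hi | ⟨hi, hi'⟩
    · left; linarith
    · left; linarith
    · left; linarith
    · right; exact ⟨by linarith, hi'.trans h'⟩

lemma rk_inj {m : ℕ} (z : Fin m → ℝ) (e : Equiv.Perm (Fin m)) {k j : Fin m}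
    (h : rk z e k = rk z e j) : k = j := by
  by_contra hne
  have hne' : e k ≠ e j := fun h => hne (e.injective h)
  have : rkBelow z e k j ∨ rkBelow z e j k := by
    unfold rkBelow
    rcases lt_trichotomy (z k) (z j) with h1 | h1 | h1
    · right; left; exact h1
    · rcases lt_or_gt_of_ne hne' with h2 | h2
      · right; right; exact ⟨h1.symm, h2⟩
      · left; right; exact ⟨h1, h2⟩
    · left; left; exact h1
  rcases this with h1 | h1
  · have := rk_lt z e h1; omega
  · have := rk_lt z e h1; omega

lemma rk_comp {m : ℕ} (z : Fin m → ℝ) (e τ : Equiv.Perm (Fin m)) (k : Fin m) :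
    rk (fun i => z (τ i)) (e * τ) k = rk z e (τ k) := by
  unfold rk
  refine Finset.card_bij (fun i _ => τ i) ?_ ?_ ?_
  · intro i hi; simpa [rkBelow] using hi
  · intro i _ j _ h; exact τ.injective h
  · intro i hi
    refine ⟨τ.symm i, ?_, by simp⟩
    simpa [rkBelow] using hi

lemma rk_meas {m : ℕ} (e : Equiv.Perm (Fin m)) (k : Fin m) (r : ℕ) :
    MeasurableSet {z : Fin m → ℝ | rk z e k = r} := by
  have : Measurable (fun z : Fin m → ℝ => rk z e k) := by
    unfold rk
    simp only [Finset.card_filter]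
    refine Finset.measurable_sum _ fun i _ => Measurable.ite ?_ measurable_const measurable_const
    unfold rkBelow
    refine MeasurableSet.union ?_ (MeasurableSet.inter ?_ (MeasurableSet.const _))
    · exact measurableSet_lt (measurable_pi_apply i) (measurable_pi_apply k)
    · exact measurableSet_eq_fun (measurable_pi_apply k) (measurable_pi_apply i)
  exact this (measurableSet_singleton r)

lemma rk_sum {m : ℕ} [NeZero m] (ν : Measure (Fin m → ℝ)) [IsProbabilityMeasure ν]
    (hν : ∀ τ : Equiv.Perm (Fin m), ν.map (fun z i => z (τ i)) = ν) (r : ℕ) :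
    (m : ℝ≥0∞) * ∑ e : Equiv.Perm (Fin m), ν {z | rk z e 0 = r} ≤ (Nat.factorial m : ℝ≥0∞) := by
  have key : ∀ k : Fin m, ∑ e : Equiv.Perm (Fin m), ν {z | rk z e 0 = r} =
      ∑ e : Equiv.Perm (Fin m), ν {z | rk z e k = r} := by
    intro k
    rw [← Equiv.sum_comp (Equiv.mulRight (Equiv.swap 0 k))]
    refine Finset.sum_congr rfl fun e _ => ?_
    conv_lhs => rw [← hν (Equiv.swap 0 k)]
    rw [Measure.map_apply (by fun_prop) (rk_meas _ _ _)]
    congr 1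
    ext z
    simp only [Set.mem_preimage, Set.mem_ofPred_eq, Equiv.coe_mulRight]
    rw [rk_comp, Equiv.swap_apply_left]
  calc (m : ℝ≥0∞) * ∑ e : Equiv.Perm (Fin m), ν {z | rk z e 0 = r}
      = ∑ k : Fin m, ∑ e : Equiv.Perm (Fin m), ν {z | rk z e k = r} := by
        rw [← Finset.sum_congr rfl fun k _ => key k]; simp
    _ = ∑ e : Equiv.Perm (Fin m), ∑ k : Fin m, ν {z | rk z e k = r} := Finset.sum_comm
    _ ≤ ∑ e : Equiv.Perm (Fin m), 1 := by
        refine Finset.sum_le_sum fun e _ => ?_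
        rw [← measure_biUnion_finset _ (fun k _ => rk_meas e k r)]
        · exact prob_le_one
        · intro k _ j _ hkj
          refine Set.disjoint_left.2 fun z h1 h2 => hkj (rk_inj z e ?_)
          simp only [Set.mem_ofPred_eq] at h1 h2
          rw [h1, h2]
    _ = _ := by simp [Fintype.card_perm]

lemma unif_aux {Ω : Type*} [MeasurableSpace Ω] (μ : Measure Ω) [IsProbabilityMeasure μ]
    (m : ℕ) [NeZero m] (f : Ω → ℕ) (hf : ∀ ω, f ω ∈ Finset.Icc 1 m)
    (hr : ∀ r, μ {ω | f ω = r} ≤ (m : ℝ≥0∞)⁻¹) (A : Finset ℕ) (hA : A ⊆ Finset.Icc 1 m) :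
    μ {ω | f ω ∈ A} = (A.card : ℝ≥0∞) * (m : ℝ≥0∞)⁻¹ := by
  have ub : ∀ B : Finset ℕ, μ {ω | f ω ∈ B} ≤ (B.card : ℝ≥0∞) * (m : ℝ≥0∞)⁻¹ := by
    intro B
    have : {ω | f ω ∈ B} = ⋃ r ∈ B, {ω | f ω = r} := by ext; simp
    rw [this]
    refine (measure_biUnion_finset_le _ _).trans ((Finset.sum_le_sum fun r _ => hr r).trans ?_)
    simp
  have hm : (m : ℝ≥0∞) ≠ 0 := by exact_mod_cast NeZero.ne m
  have hm' : (m : ℝ≥0∞) ≠ ∞ := ENNReal.natCast_ne_top m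
  refine le_antisymm (ub A) ?_
  have hc := ub (Finset.Icc 1 m \ A)
  have hu : (1 : ℝ≥0∞) ≤ μ {ω | f ω ∈ A} + μ {ω | f ω ∈ Finset.Icc 1 m \ A} := by
    rw [← measure_univ (μ := μ)]
    refine (measure_mono ?_).trans (measure_union_le _ _)
    intro ω _
    have := hf ω
    by_cases h : f ω ∈ A
    · left; exact h
    · right; exact Finset.mem_sdiff.2 ⟨this, h⟩
  have hcard : (Finset.Icc 1 m \ A).card + A.card = m := by
    rw [Finset.card_sdiff_add_card_eq_card hA]; simp
  have h1 : ((Finset.Icc 1 m \ A).card : ℝ≥0∞) * (m : ℝ≥0∞)⁻¹ + A.card * (m : ℝ≥0∞)⁻¹ = 1 := by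
    rw [← add_mul, ← Nat.cast_add, hcard, ENNReal.mul_inv_cancel hm hm']
  have hfin : ((Finset.Icc 1 m \ A).card : ℝ≥0∞) * (m : ℝ≥0∞)⁻¹ ≠ ∞ :=
    ENNReal.mul_ne_top (ENNReal.natCast_ne_top _) (ENNReal.inv_ne_top.2 hm)
  rw [← ENNReal.add_le_add_iff_left hfin, h1, add_comm]
  exact hu.trans (by gcongr)

/-- **Uniformity of the tie-broken rank.**  If `(Z_0, …, Z_{m-1})` is an
exchangeable family of real random variables and `π` is a uniform random
permutation of `{0, …, m-1}` independent of `(Z_0, …, Z_{m-1})`, then the rank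
`R = 1 + #{i ≠ 0 : Z_0 ≻_π Z_i}` (with ties broken by `π`) is uniformly
distributed on `{1, …, m}`; in particular `P(R ≤ m - q) = 1 - q/m` for `0 < q < m`. -/
theorem rank_of_exchangeable_uniform
    {Ω : Type*} [MeasurableSpace Ω] (μ : Measure Ω) [IsProbabilityMeasure μ]
    (m : ℕ) [NeZero m] (Z : Fin m → Ω → ℝ)
    (hZmeas : ∀ i, Measurable (Z i))
    (hexch : ∀ τ : Equiv.Perm (Fin m),
      Measure.map (fun ω => fun i : Fin m => Z (τ i) ω) μ =
        Measure.map (fun ω => fun i : Fin m => Z i ω) μ)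
    (π : Ω → Equiv.Perm (Fin m))
    (hπunif : ∀ e : Equiv.Perm (Fin m), μ {ω | π ω = e} = (Nat.factorial m : ℝ≥0∞)⁻¹)
    (hπindep : IndepFun π (fun ω => fun i : Fin m => Z i ω) μ) :
    (∀ r : ℕ, 1 ≤ r → r ≤ m →
      μ {ω | 1 + (Finset.univ.filter (fun i : Fin m => i ≠ 0 ∧
        (Z 0 ω > Z i ω ∨ (Z 0 ω = Z i ω ∧ π ω i < π ω 0)))).card = r}
        = (m : ℝ≥0∞)⁻¹) ∧
    (∀ q : ℕ, 0 < q → q < m →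
      μ {ω | 1 + (Finset.univ.filter (fun i : Fin m => i ≠ 0 ∧
        (Z 0 ω > Z i ω ∨ (Z 0 ω = Z i ω ∧ π ω i < π ω 0)))).card ≤ m - q}
        = 1 - (q : ℝ≥0∞) / m) := by
  have hZ : Measurable (fun ω => fun i : Fin m => Z i ω) := measurable_pi_lambda _ hZmeas
  set ν := Measure.map (fun ω => fun i : Fin m => Z i ω) μ with hνdef
  have : IsProbabilityMeasure ν := Measure.isProbabilityMeasure_map hZ.aemeasurable
  have hν : ∀ τ : Equiv.Perm (Fin m), ν.map (fun z i => z (τ i)) = ν := by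
    intro τ
    rw [hνdef, Measure.map_map (by fun_prop) hZ]
    exact hexch τ
  have hm : (m : ℝ≥0∞) ≠ 0 := by exact_mod_cast NeZero.ne m
  have hm' : (m : ℝ≥0∞) ≠ ∞ := ENNReal.natCast_ne_top m
  have hF : (Nat.factorial m : ℝ≥0∞) ≠ 0 := by exact_mod_cast Nat.factorial_ne_zero m
  have hF' : (Nat.factorial m : ℝ≥0∞) ≠ ∞ := ENNReal.natCast_ne_top _
  have hR : ∀ ω, 1 + (Finset.univ.filter (fun i : Fin m => i ≠ 0 ∧
        (Z 0 ω > Z i ω ∨ (Z 0 ω = Z i ω ∧ π ω i < π ω 0)))).card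
        = 1 + rk (fun i => Z i ω) (π ω) 0 := by
    intro ω
    unfold rk
    congr 2
    ext i
    rw [Finset.mem_filter, Finset.mem_filter]
    unfold rkBelow
    constructor
    · exact fun h => ⟨h.1, h.2.2⟩
    · refine fun h => ⟨h.1, ?_, h.2⟩
      rintro rfl
      simp at h
  simp only [hR]
  have hmem : ∀ ω, 1 + rk (fun i => Z i ω) (π ω) 0 ∈ Finset.Icc 1 m := by
    intro ω
    have : rk (fun i => Z i ω) (π ω) 0 < m := by
      unfold rk
      conv_rhs => rw [← Fintype.card_fin m, ← Finset.card_univ]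
      apply Finset.card_lt_card
      rw [Finset.ssubset_iff_of_subset (Finset.subset_univ _)]
      exact ⟨0, Finset.mem_univ _, by simp [rkBelow]⟩
    rw [Finset.mem_Icc]; omega
  have hle0 : ∀ r, μ {ω | rk (fun i => Z i ω) (π ω) 0 = r} ≤ (m : ℝ≥0∞)⁻¹ := by
    intro r
    have hsub : {ω | rk (fun i => Z i ω) (π ω) 0 = r} ⊆
        ⋃ e ∈ (Finset.univ : Finset (Equiv.Perm (Fin m))), (π ⁻¹' {e} ∩
          (fun ω => fun i : Fin m => Z i ω) ⁻¹' {z | rk z e 0 = r}) := by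
      intro ω hω
      simpa using hω
    refine (measure_mono hsub).trans ((measure_biUnion_finset_le _ _).trans ?_)
    have : ∀ e : Equiv.Perm (Fin m), μ (π ⁻¹' {e} ∩
          (fun ω => fun i : Fin m => Z i ω) ⁻¹' {z | rk z e 0 = r}) =
          (Nat.factorial m : ℝ≥0∞)⁻¹ * ν {z | rk z e 0 = r} := by
      intro e
      rw [hπindep.measure_inter_preimage_eq_mul _ _ (show MeasurableSet {e} from trivial)
        (rk_meas e 0 r),
        hνdef, Measure.map_apply hZ (rk_meas e 0 r), ← hπunif e]
      rfl
    rw [Finset.sum_congr rfl fun e _ => this e, ← Finset.mul_sum]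
    have h := rk_sum ν hν r
    rw [ENNReal.le_inv_iff_mul_le]
    calc _ = (Nat.factorial m : ℝ≥0∞)⁻¹ *
          ((m : ℝ≥0∞) * ∑ e : Equiv.Perm (Fin m), ν {z | rk z e 0 = r}) := by ring
      _ ≤ (Nat.factorial m : ℝ≥0∞)⁻¹ * Nat.factorial m := by gcongr
      _ = 1 := ENNReal.inv_mul_cancel hF hF'
  have hle : ∀ r, μ {ω | 1 + rk (fun i => Z i ω) (π ω) 0 = r} ≤ (m : ℝ≥0∞)⁻¹ := by
    intro r
    refine (measure_mono ?_).trans (hle0 (r - 1))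
    intro ω hω
    simp only [Set.mem_ofPred_eq] at hω ⊢
    omega
  have main := unif_aux μ m _ hmem hle
  constructor
  · intro r h1 h2
    have := main {r} (by simp [h1, h2])
    simpa using this
  · intro q h0 hq
    have := main (Finset.Icc 1 (m - q)) (Finset.Icc_subset_Icc le_rfl (by omega))
    simp only [Finset.mem_Icc, Nat.card_Icc, Nat.le_add_right, true_and, Nat.add_sub_cancel]
      at this
    rw [this, ENNReal.natCast_sub, ENNReal.sub_mul (fun _ _ => ENNReal.inv_ne_top.2 hm),
      ENNReal.mul_inv_cancel hm hm', div_eq_mul_inv]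

end
end
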